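/- arXiv:1905.02309 — 2 statements merged into one kernel-verified Lean document; each statement's English description precedes it below -/
import Mathlib

section
/- Let k ≥ 2, let T be a set of sum indecomposable permutation patterns, let n ≥ 2, and set m = ⌈(n−1)/k⌉. If λ ∈ S_m is a k-ary heap permutation avoiding every pattern in T, and μ ∈ S_{n−m} avoids every pattern in T, then λ⊕μ ∈ S_n is a k-ary heap permutation avoiding every pattern in T. -/
open Filter Topology
open scoped ENNReal

/-- `σ ∈ S_n` contains the pattern `τ ∈ S_m`. -/
def PermContains {n m : ℕ} (σ : Equiv.Perm (Fin n)) (τ : Equiv.Perm (Fin m)) : Prop :=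
  ∃ f : Fin m → Fin n, StrictMono f ∧ ∀ j k : Fin m, σ (f j) < σ (f k) ↔ τ j < τ k

/-- `σ` avoids every pattern in the set `T`. -/
def AvoidsAll {n : ℕ} (σ : Equiv.Perm (Fin n)) (T : Set (Σ m, Equiv.Perm (Fin m))) : Prop :=
  ∀ τ ∈ T, ¬ PermContains σ τ.2

/-- The direct sum `λ ⊕ μ` of two permutations. -/
def directSum {l m : ℕ} (lam : Equiv.Perm (Fin l)) (mu : Equiv.Perm (Fin m)) :
    Equiv.Perm (Fin (l + m)) :=
  finSumFinEquiv.symm.trans ((Equiv.sumCongr lam mu).trans finSumFinEquiv)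

/-- A permutation is sum indecomposable if it is not a direct sum of two shorter permutations. -/
def SumIndecomposable {n : ℕ} (σ : Equiv.Perm (Fin n)) : Prop :=
  ¬ ∃ (l m : ℕ) (_ : 0 < l) (_ : 0 < m) (lam : Equiv.Perm (Fin l)) (mu : Equiv.Perm (Fin m))
      (h : l + m = n), σ = h ▸ directSum lam mu

/-- `σ ∈ S_n` is the permutation associated to a `k`-ary heap: in 1-indexed terms,
`σ(⌈(i−1)/k⌉) < σ(i)` for all `2 ≤ i ≤ n`; here `i : Fin n` is the 0-indexed vertex,
whose 0-indexed parent is `(i−1)/k` (floor division). -/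
def IsHeapPerm (k : ℕ) {n : ℕ} (σ : Equiv.Perm (Fin n)) : Prop :=
  ∀ i : Fin n, 1 ≤ (i : ℕ) →
    σ ⟨((i : ℕ) - 1) / k,
        lt_of_le_of_lt (le_trans (Nat.div_le_self _ _) (Nat.sub_le _ _)) i.isLt⟩ < σ i

/-- `|Av_n(T)|`. -/
noncomputable def avCount (T : Set (Σ m, Equiv.Perm (Fin m))) (n : ℕ) : ℕ :=
  Nat.card {σ : Equiv.Perm (Fin n) // AvoidsAll σ T}

/-- `|H_n^k(T)|`. -/
noncomputable def heapCount (k : ℕ) (T : Set (Σ m, Equiv.Perm (Fin m))) (n : ℕ) : ℕ :=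
  Nat.card {σ : Equiv.Perm (Fin n) // IsHeapPerm k σ ∧ AvoidsAll σ T}

theorem directSum_val_of_lt {l m : ℕ} (lam : Equiv.Perm (Fin l)) (mu : Equiv.Perm (Fin m))
    (i : Fin (l + m)) (hi : (i : ℕ) < l) : (directSum lam mu i : ℕ) = lam ⟨i, hi⟩ := by
  obtain ⟨j, rfl⟩ : ∃ j : Fin l, i = Fin.castAdd m j := ⟨⟨i, hi⟩, rfl⟩
  simp [directSum]

theorem directSum_val_of_le {l m : ℕ} (lam : Equiv.Perm (Fin l)) (mu : Equiv.Perm (Fin m))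
    (i : Fin (l + m)) (hi : l ≤ (i : ℕ)) :
    (directSum lam mu i : ℕ) = l + mu ⟨i - l, by omega⟩ := by
  obtain ⟨j, rfl⟩ : ∃ j : Fin m, i = Fin.natAdd l j :=
    ⟨⟨i - l, by omega⟩, Fin.ext (by simp; omega)⟩
  simp [directSum]

theorem directSum_lt_directSum {l m : ℕ} (lam : Equiv.Perm (Fin l)) (mu : Equiv.Perm (Fin m))
    {i j : Fin (l + m)} (hi : (i : ℕ) < l) (hj : l ≤ (j : ℕ)) :
    directSum lam mu i < directSum lam mu j := by
  rw [Fin.lt_def, directSum_val_of_lt lam mu i hi, directSum_val_of_le lam mu j hj]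
  omega

/-- A permutation whose first `a` values all lie below its other values is a direct sum. -/
theorem exists_eq_directSum {a b : ℕ} (τ : Equiv.Perm (Fin (a + b)))
    (hτ : ∀ i j : Fin (a + b), (i : ℕ) < a → a ≤ (j : ℕ) → τ i < τ j) :
    ∃ (lam : Equiv.Perm (Fin a)) (mu : Equiv.Perm (Fin b)), τ = directSum lam mu := by
  have low (i : Fin a) : (τ (Fin.castAdd b i) : ℕ) < a := by
    have hcard := Finset.card_le_card_of_injOn (s := (Finset.univ : Finset (Fin b)))
      (t := Finset.Ioi (τ (Fin.castAdd b i))) (fun j => τ (Fin.natAdd a j))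
      (fun j _ => by simpa using hτ _ _ (by simp) (by simp))
      (fun x _ y _ hxy => by simpa using hxy)
    simp only [Finset.card_univ, Fintype.card_fin, Fin.card_Ioi] at hcard
    omega
  have high (j : Fin b) : a ≤ (τ (Fin.natAdd a j) : ℕ) := by
    have hcard := Finset.card_le_card_of_injOn (s := (Finset.univ : Finset (Fin a)))
      (t := Finset.Iio (τ (Fin.natAdd a j))) (fun i => τ (Fin.castAdd b i))
      (fun i _ => by simpa using hτ _ _ (by simp) (by simp))
      (fun x _ y _ hxy => by simpa using hxy)
    simpa using hcard
  have lamInj : Function.Injective fun i : Fin a =>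
      (⟨τ (Fin.castAdd b i), low i⟩ : Fin a) := fun x y hxy => by
    simpa [Fin.val_inj] using hxy
  have muInj : Function.Injective fun j : Fin b =>
      (⟨τ (Fin.natAdd a j) - a, by have := high j; omega⟩ : Fin b) := fun x y hxy => by
    have hx := high x
    have hy := high y
    have hsub : (τ (Fin.natAdd a x) : ℕ) - a = τ (Fin.natAdd a y) - a := congrArg Fin.val hxy
    have heq : τ (Fin.natAdd a x) = τ (Fin.natAdd a y) := Fin.ext (by omega)
    simpa using heq
  refine ⟨Equiv.ofBijective _ (Finite.injective_iff_bijective.mp lamInj),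
    Equiv.ofBijective _ (Finite.injective_iff_bijective.mp muInj), Equiv.ext fun i => ?_⟩
  refine Fin.addCases (fun x => ?_) (fun x => ?_) i
  · simp [directSum]
  · have hx := high x
    ext
    simp [directSum]
    omega

theorem SumIndecomposable.permContains_or {l m p : ℕ} {τ : Equiv.Perm (Fin p)}
    (hτ : SumIndecomposable τ) {lam : Equiv.Perm (Fin l)} {mu : Equiv.Perm (Fin m)}
    (hc : PermContains (directSum lam mu) τ) : PermContains lam τ ∨ PermContains mu τ := by
  obtain ⟨f, hf, hfτ⟩ := hc
  by_cases hlow : ∀ j, (f j : ℕ) < l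
  · refine .inl ⟨fun j => ⟨f j, hlow j⟩, fun i j hij => hf hij, fun i j => ?_⟩
    rw [← hfτ, Fin.lt_def, Fin.lt_def, directSum_val_of_lt _ _ _ (hlow i),
      directSum_val_of_lt _ _ _ (hlow j)]
  by_cases hhigh : ∀ j, l ≤ (f j : ℕ)
  · refine .inr ⟨fun j => ⟨f j - l, by have := hhigh j; omega⟩, fun i j hij => ?_, fun i j => ?_⟩
    · have hi := hhigh i
      have hlt : (f i : ℕ) < f j := hf hij
      simp only [Fin.mk_lt_mk]
      omega
    · rw [← hfτ, Fin.lt_def, Fin.lt_def, directSum_val_of_le _ _ _ (hhigh i),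
        directSum_val_of_le _ _ _ (hhigh j), Nat.add_lt_add_iff_left]
  push Not at hlow hhigh
  obtain ⟨i₀, hi₀⟩ := hhigh
  have hex : ∃ a, ∃ ha : a < p, l ≤ (f ⟨a, ha⟩ : ℕ) := by
    obtain ⟨j, hj⟩ := hlow
    exact ⟨j, j.isLt, hj⟩
  classical
  obtain ⟨a, ⟨ha, hfa⟩, hmin⟩ : ∃ a, (∃ ha : a < p, l ≤ (f ⟨a, ha⟩ : ℕ)) ∧
      ∀ i : Fin p, (i : ℕ) < a → (f i : ℕ) < l :=
    ⟨Nat.find hex, Nat.find_spec hex, fun i hi => by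
      by_contra! hle
      exact Nat.find_min hex hi ⟨i.isLt, hle⟩⟩
  have hge (j : Fin p) (hj : a ≤ (j : ℕ)) : l ≤ (f j : ℕ) :=
    hfa.trans (hf.monotone (Fin.le_def.mpr hj))
  have hpos : 0 < a := by
    by_contra! h0
    have := hge i₀ (by omega)
    omega
  obtain ⟨b, rfl⟩ := Nat.exists_eq_add_of_lt ha
  obtain ⟨lam', mu', heq⟩ := exists_eq_directSum (a := a) (b := b + 1) τ fun i j hi hj =>
    (hfτ i j).mp (directSum_lt_directSum lam mu (hmin i hi) (hge j hj))
  exact (hτ ⟨a, b + 1, hpos, b.succ_pos, lam', mu', rfl, heq⟩).elim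

theorem AvoidsAll.directSum {l m : ℕ} {lam : Equiv.Perm (Fin l)} {mu : Equiv.Perm (Fin m)}
    {T : Set (Σ m, Equiv.Perm (Fin m))} (hT : ∀ τ ∈ T, SumIndecomposable τ.2)
    (hlam : AvoidsAll lam T) (hmu : AvoidsAll mu T) : AvoidsAll (directSum lam mu) T :=
  fun τ hτ hc => ((hT τ hτ).permContains_or hc).elim (hlam τ hτ) (hmu τ hτ)

/-- A direct sum is a heap permutation if its first summand is one and contains all parents. -/
theorem IsHeapPerm.directSum {k l m : ℕ} {lam : Equiv.Perm (Fin l)} (hlam : IsHeapPerm k lam)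
    (mu : Equiv.Perm (Fin m)) (hparent : (l + m - 2) / k < l) :
    IsHeapPerm k (directSum lam mu) := by
  intro i hi
  have hlt : ((i : ℕ) - 1) / k < l :=
    (Nat.div_le_div_right (by omega)).trans_lt hparent
  rcases lt_or_ge (i : ℕ) l with hil | hil
  · rw [Fin.lt_def, directSum_val_of_lt _ _ _ hlt, directSum_val_of_lt _ _ _ hil]
    exact hlam ⟨i, hil⟩ hi
  · exact directSum_lt_directSum lam mu hlt hil

theorem isHeapPerm_and_avoidsAll_cast_directSum {k l m n : ℕ} {lam : Equiv.Perm (Fin l)}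
    {mu : Equiv.Perm (Fin m)} {T : Set (Σ m, Equiv.Perm (Fin m))}
    (hT : ∀ τ ∈ T, SumIndecomposable τ.2) (hheap : IsHeapPerm k lam) (hlam : AvoidsAll lam T)
    (hmu : AvoidsAll mu T) (h : l + m = n) (hparent : (n - 2) / k < l) :
    IsHeapPerm k (h ▸ directSum lam mu) ∧ AvoidsAll (h ▸ directSum lam mu) T := by
  subst h
  exact ⟨hheap.directSum mu hparent, .directSum hT hlam hmu⟩

/-- **The Claim in the proof of Theorem 1.** Let `k ≥ 2`, `T` a set of sum indecomposable
patterns, `n ≥ 2`, and `m = ⌈(n−1)/k⌉` (written as `(n + k - 2) / k` in ℕ).  If `λ ∈ S_m` is a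
`k`-ary heap permutation avoiding every pattern of `T` and `μ ∈ S_{n−m}` avoids every pattern
of `T`, then `λ ⊕ μ ∈ S_n` is a `k`-ary heap permutation avoiding every pattern of `T`. -/
theorem heap_directSum_claim (k n : ℕ) (hk : 2 ≤ k) (hn : 2 ≤ n)
    (T : Set (Σ m, Equiv.Perm (Fin m))) (hT : ∀ τ ∈ T, SumIndecomposable τ.2)
    (lam : Equiv.Perm (Fin ((n + k - 2) / k)))
    (mu : Equiv.Perm (Fin (n - (n + k - 2) / k)))
    (hlamHeap : IsHeapPerm k lam) (hlamAv : AvoidsAll lam T) (hmuAv : AvoidsAll mu T)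
    (h : (n + k - 2) / k + (n - (n + k - 2) / k) = n) :
    IsHeapPerm k (h ▸ directSum lam mu) ∧ AvoidsAll (h ▸ directSum lam mu) T := by
  refine isHeapPerm_and_avoidsAll_cast_directSum hT hlamHeap hlamAv hmuAv h ?_
  rw [show n + k - 2 = n - 2 + k by omega, Nat.add_div_right _ (by omega)]
  exact Nat.lt_succ_self _
end

section
/- For all integers t ≥ 1, N_{3,t}(1243)(q) = Σ_{i=1}^{t} Σ_{j=i+1}^{2t} q^{3t²−3t+i+j} as polynomials in q. -/
open Polynomial

/-- The pattern `1243` (0-indexed). -/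
def pat1243 : Equiv.Perm (Fin 4) := ⟨![0, 1, 3, 2], ![0, 1, 3, 2], by decide, by decide⟩

/-- The pattern `2143` (0-indexed). -/
def pat2143 : Equiv.Perm (Fin 4) := ⟨![1, 0, 3, 2], ![1, 0, 3, 2], by decide, by decide⟩

/-- `w ∈ S_{st}` (a word recorded as a permutation of `Fin (s*t)`, positions and labels both
0-indexed, 0-indexed label `a` standing for the poset label `a+1`) encodes a linear extension
of the rectangular poset `N_{s,t}`: for every label `a ∈ [st]`, if `t ∤ a` then `a` appears
before `a+1`, and if `a > t` then `a` appears before `a−t`.  ("`a` appears before `b`" means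
`w.symm a < w.symm b`.) -/
def IsLinExtN (s t : ℕ) (w : Equiv.Perm (Fin (s * t))) : Prop :=
  (∀ a b : Fin (s * t), (b : ℕ) = (a : ℕ) + 1 → ¬ (t ∣ ((a : ℕ) + 1)) →
      w.symm a < w.symm b) ∧
  (∀ a b : Fin (s * t), (b : ℕ) + t = (a : ℕ) → w.symm a < w.symm b)

/-- The number of inversions of `w`. -/
def invCount {n : ℕ} (w : Equiv.Perm (Fin n)) : ℕ :=
  (Finset.univ.filter fun p : Fin n × Fin n => p.1 < p.2 ∧ w p.2 < w p.1).card

open Classical in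
/-- The polynomial `N_{s,t}(τ)(q) = Σ_{w ∈ N_{s,t}(τ)} q^{inv(w)}`. -/
noncomputable def NPoly (s t : ℕ) {m : ℕ} (τ : Equiv.Perm (Fin m)) : Polynomial ℤ :=
  ∑ w ∈ Finset.univ.filter
      (fun w : Equiv.Perm (Fin (s * t)) => IsLinExtN s t w ∧ ¬ PermContains w τ),
    (X : Polynomial ℤ) ^ invCount w

/-- The position of the label `l ≥ t` among the labels `≥ t`, when the label `t` is preceded by
exactly the `i` labels `2t, …, 2t + i - 1` and all other labels of its row come last. -/
def upperSlot (t i l : ℕ) : ℕ :=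
  if l = t then i else if l < 2 * t then l else if l - 2 * t < i then l - 2 * t else l - 2 * t + 1

/-- The position of the label `l` in the `1243`-avoiding linear extension of `N_{3,t}` in which the
label `t` has position `i` and the label `0` has position `j`. -/
def slot (t i j l : ℕ) : ℕ :=
  if l = 0 then j else if l < t then 2 * t + l
  else if upperSlot t i l < j then upperSlot t i l else upperSlot t i l + 1

lemma upperSlot_cases (t i l : ℕ) : l < t ∨ l = t ∧ upperSlot t i l = i ∨
    t < l ∧ l < 2 * t ∧ upperSlot t i l = l ∨
    2 * t ≤ l ∧ t < l ∧ l < 2 * t + i ∧ upperSlot t i l = l - 2 * t ∨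
    2 * t + i ≤ l ∧ t < l ∧ upperSlot t i l = l - 2 * t + 1 := by
  unfold upperSlot
  split_ifs <;> omega

lemma slot_cases (t i j l : ℕ) : l = 0 ∧ slot t i j l = j ∨
    0 < l ∧ l < t ∧ slot t i j l = 2 * t + l ∨
    0 < l ∧ t ≤ l ∧ upperSlot t i l < j ∧ slot t i j l = upperSlot t i l ∨
    0 < l ∧ t ≤ l ∧ j ≤ upperSlot t i l ∧ slot t i j l = upperSlot t i l + 1 := by
  unfold slot
  split_ifs <;> omega

lemma slot_lt {t i j l : ℕ} (hit : i ≤ t) (hj : j ≤ 2 * t) (hl : l < 3 * t) :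
    slot t i j l < 3 * t := by
  have := slot_cases t i j l
  have := upperSlot_cases t i l
  omega

lemma upperSlot_inj {t i a b : ℕ} (hit : i ≤ t) (ha : t ≤ a) (hb : t ≤ b)
    (ha' : a < 3 * t) (hb' : b < 3 * t)
    (h : upperSlot t i a = upperSlot t i b) : a = b := by
  have := upperSlot_cases t i a
  have := upperSlot_cases t i b
  omega

lemma upperSlot_lt {t i a : ℕ} (hit : i ≤ t) (ht : 1 ≤ t) (ha : a < 3 * t) :
    upperSlot t i a < 2 * t ∨ a < t := by
  have := upperSlot_cases t i a
  omega

lemma slot_inj {t i j a b : ℕ} (hit : i ≤ t) (hj : j ≤ 2 * t)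
    (ha : a < 3 * t) (hb : b < 3 * t) (h : slot t i j a = slot t i j b) : a = b := by
  have h1 := upperSlot_lt hit (by omega) ha
  have h2 := upperSlot_lt hit (by omega) hb
  have h3 := @upperSlot_inj t i a b hit
  have := slot_cases t i j a
  have := slot_cases t i j b
  omega

/-- The word whose label `l` sits at position `slot t i j l`. -/
noncomputable def slotPerm (t i j : ℕ) (hit : i ≤ t) (hj : j ≤ 2 * t) :
    Equiv.Perm (Fin (3 * t)) :=
  (Equiv.ofBijective (fun l : Fin (3 * t) => (⟨slot t i j l, slot_lt hit hj l.2⟩ : Fin (3 * t)))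
    (Finite.injective_iff_bijective.mp fun a b h =>
      Fin.ext (slot_inj hit hj a.2 b.2 (congrArg Fin.val h)))).symm

lemma slotPerm_symm_val {t i j : ℕ} (hit : i ≤ t) (hj : j ≤ 2 * t) (l : Fin (3 * t)) :
    ((slotPerm t i j hit hj).symm l : ℕ) = slot t i j l := rfl

lemma slot_zero (t i j : ℕ) : slot t i j 0 = j := by simp [slot]

lemma slot_self {t i j : ℕ} (ht : 1 ≤ t) (hij : i < j) : slot t i j t = i := by
  have := slot_cases t i j t
  have := upperSlot_cases t i t
  omega

lemma slot_upper_lt {t i j l : ℕ} (hit : i ≤ t) (hj : j ≤ 2 * t) (h1 : t ≤ l) (h2 : l < 3 * t) :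
    slot t i j l ≤ 2 * t := by
  have := slot_cases t i j l
  have := upperSlot_cases t i l
  omega

lemma slot_lower {t i j l : ℕ} (h0 : l ≠ 0) (h1 : l < t) : slot t i j l = 2 * t + l := by
  simp [slot, h0, h1]

lemma slot_row_lt {t i j a : ℕ} (h : ¬ t ∣ a + 1) (ha : a + 1 < 3 * t) (hi : 1 ≤ i)
    (hit : i ≤ t) (hij : i < j) (hj : j ≤ 2 * t) : slot t i j a < slot t i j (a + 1) := by
  have h1 : a + 1 ≠ t := fun e => h ⟨1, by omega⟩
  have h2 : a + 1 ≠ 2 * t := fun e => h ⟨2, by omega⟩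
  have := slot_cases t i j a
  have := upperSlot_cases t i a
  have := slot_cases t i j (a + 1)
  have := upperSlot_cases t i (a + 1)
  omega

lemma slot_column_lt {t i j a : ℕ} (ha : a + t < 3 * t) (hi : 1 ≤ i)
    (hit : i ≤ t) (hij : i < j) : slot t i j (a + t) < slot t i j a := by
  have := slot_cases t i j a
  have := upperSlot_cases t i a
  have := slot_cases t i j (a + t)
  have := upperSlot_cases t i (a + t)
  omega

lemma eq_zero_or_eq_of_slot_lt_top {t i j b d : ℕ} (hj : j ≤ 2 * t) (hb : b < 2 * t)
    (hd : 2 * t ≤ d) (hd' : d < 3 * t)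
    (h : slot t i j b < slot t i j d) : b = 0 ∨ b = t := by
  have := slot_cases t i j b
  have := upperSlot_cases t i b
  have := slot_cases t i j d
  have := upperSlot_cases t i d
  omega

lemma slot_strictMono_top {t i j c d : ℕ} (ht : 1 ≤ t) (hc : 2 * t ≤ c) (hcd : c < d) :
    slot t i j c < slot t i j d := by
  have := slot_cases t i j c
  have := upperSlot_cases t i c
  have := slot_cases t i j d
  have := upperSlot_cases t i d
  omega

lemma slot_strictMono_middle {t i j c d : ℕ} (hit : i ≤ t) (hc : t ≤ c)
    (hcd : c < d) (hd : d < 2 * t) : slot t i j c < slot t i j d := by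
  have := slot_cases t i j c
  have := upperSlot_cases t i c
  have := slot_cases t i j d
  have := upperSlot_cases t i d
  omega

lemma slot_avoids {t i j a b c d : ℕ} (hit : i ≤ t) (hij : i < j) (hj : j ≤ 2 * t)
    (hab : a < b) (hbc : b < c) (hcd : c < d) (hd : d < 3 * t)
    (h1 : slot t i j a < slot t i j b) (h2 : slot t i j b < slot t i j d)
    (h3 : slot t i j d < slot t i j c) : False := by
  rcases lt_or_ge c t with hc | hc
  · rw [slot_lower (by omega) (hbc.trans hc)] at h2
    rw [slot_lower (by omega) hc] at h3
    rcases lt_or_ge d t with hd' | hd'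
    · rw [slot_lower (by omega) hd'] at h3
      omega
    · have := slot_upper_lt hit hj hd' hd
      omega
  rcases lt_or_ge c (2 * t) with hc' | hc'
  · rcases lt_or_ge d (2 * t) with hd' | hd'
    · exact absurd h3 (slot_strictMono_middle hit hc hcd hd').le.not_gt
    · have e1 := eq_zero_or_eq_of_slot_lt_top hj (hbc.trans hc') hd' hd h2
      have e2 := eq_zero_or_eq_of_slot_lt_top hj (by omega) hd' hd (h1.trans h2)
      obtain rfl : a = 0 := by omega
      obtain rfl : b = t := by omega
      rw [slot_zero, slot_self (by omega) hij] at h1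
      omega
  · exact absurd h3 (slot_strictMono_top (by omega) hc' hcd).le.not_gt

lemma permContains_pat1243_iff {n : ℕ} (w : Equiv.Perm (Fin n)) :
    PermContains w pat1243 ↔ ∃ a b c d : Fin n, a < b ∧ b < c ∧ c < d ∧
      w.symm a < w.symm b ∧ w.symm b < w.symm d ∧ w.symm d < w.symm c := by
  constructor
  · rintro ⟨f, hf, h⟩
    refine ⟨w (f 0), w (f 1), w (f 3), w (f 2), (h 0 1).2 (by decide), (h 1 3).2 (by decide),
      (h 3 2).2 (by decide), ?_⟩
    simp only [Equiv.symm_apply_apply]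
    exact ⟨hf (by decide), hf (by decide), hf (by decide)⟩
  · rintro ⟨a, b, c, d, hab, hbc, hcd, h1, h2, h3⟩
    refine ⟨![w.symm a, w.symm b, w.symm d, w.symm c], ?_, ?_⟩
    · rw [Fin.strictMono_iff_lt_succ]
      intro k
      fin_cases k
      exacts [h1, h2, h3]
    · have h4 := hab.trans hbc
      have h5 := hbc.trans hcd
      have h6 := h4.trans hcd
      intro j k
      fin_cases j <;> fin_cases k <;>
        simp [pat1243, hab, hbc, hcd, h4, h5, h6, hab.le, hbc.le, hcd.le, h4.le, h5.le, h6.le]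

lemma isLinExtN_slotPerm {t i j : ℕ} (hi : 1 ≤ i) (hit : i ≤ t) (hij : i < j) (hj : j ≤ 2 * t) :
    IsLinExtN 3 t (slotPerm t i j hit hj) := by
  constructor
  · intro a b hb h
    rw [Fin.lt_def, slotPerm_symm_val, slotPerm_symm_val, hb]
    exact slot_row_lt h (hb ▸ b.2) hi hit hij hj
  · intro a b hb
    rw [Fin.lt_def, slotPerm_symm_val, slotPerm_symm_val, ← hb]
    exact slot_column_lt (hb ▸ a.2) hi hit hij

lemma not_permContains_slotPerm {t i j : ℕ} (hit : i ≤ t) (hij : i < j) (hj : j ≤ 2 * t) :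
    ¬ PermContains (slotPerm t i j hit hj) pat1243 := by
  rw [permContains_pat1243_iff]
  rintro ⟨a, b, c, d, hab, hbc, hcd, h1, h2, h3⟩
  exact slot_avoids hit hij hj hab hbc hcd d.2 h1 h2 h3

/-- Inversions counted by labels: the number of later labels placed before a given label. -/
lemma invCount_eq_sum {n : ℕ} (w : Equiv.Perm (Fin n)) :
    invCount w = ∑ a : Fin n, (Finset.univ.filter fun b => a < b ∧ w.symm b < w.symm a).card := by
  rw [invCount, ← Finset.card_sigma]
  refine Finset.card_bij' (fun p _ => ⟨w p.2, w p.1⟩) (fun q _ => (w.symm q.2, w.symm q.1))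
    ?_ ?_ ?_ ?_ <;> simp +contextual

lemma card_slot_lt {t i j m : ℕ} (hit : i ≤ t) (hj : j ≤ 2 * t) (hm : m ≤ 3 * t) :
    (Finset.univ.filter fun b : Fin (3 * t) => slot t i j b < m).card = m := by
  have : (Finset.univ.filter fun b : Fin (3 * t) => slot t i j b < m).card =
      (Finset.univ.filter fun b : Fin (3 * t) => (b : ℕ) < m).card :=
    Finset.card_equiv (slotPerm t i j hit hj).symm (by
      intro b
      simp [slotPerm_symm_val])
  rw [this, Fin.card_filter_val_lt, min_eq_right hm]

lemma card_le_val (n m : ℕ) :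
    (Finset.univ.filter fun b : Fin n => m ≤ (b : ℕ)).card = n - m := by
  have h := Finset.card_filter_add_card_filter_not (s := (Finset.univ : Finset (Fin n)))
    (fun b : Fin n => (b : ℕ) < m)
  simp only [not_lt, Fin.card_filter_val_lt, Finset.card_univ, Fintype.card_fin] at h
  omega

lemma card_inversions_label {t i j : ℕ} (hit : i ≤ t) (hij : i < j)
    (hj : j ≤ 2 * t) (a : Fin (3 * t)) :
    (Finset.univ.filter fun b => a < b ∧
      (slotPerm t i j hit hj).symm b < (slotPerm t i j hit hj).symm a).card =
    if (a : ℕ) = 0 then j else if (a : ℕ) < t then 2 * t else if (a : ℕ) = t then i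
    else if (a : ℕ) < 2 * t then t else 0 := by
  simp only [Fin.lt_def, slotPerm_symm_val]
  obtain ⟨a, ha⟩ := a
  dsimp only
  split_ifs with h1 h2 h3 h4
  · conv_rhs => rw [← card_slot_lt hit hj (show j ≤ 3 * t by omega)]
    congr 1
    ext b
    simp only [Finset.mem_filter, Finset.mem_univ, true_and, h1, slot_zero, and_iff_right_iff_imp]
    intro h
    by_contra h0
    rw [show (b : ℕ) = 0 by omega, slot_zero] at h
    omega
  · rw [show 2 * t = 3 * t - t by omega, ← card_le_val]
    congr 1
    ext b
    have hb := b.2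
    simp only [Finset.mem_filter, Finset.mem_univ, true_and, slot_lower h1 h2]
    constructor
    · rintro ⟨h, h'⟩
      by_contra hb'
      rw [slot_lower (by omega) (by omega)] at h'
      omega
    · intro h
      have := slot_upper_lt hit hj h b.2
      omega
  · conv_rhs => rw [← card_slot_lt hit hj (show i ≤ 3 * t by omega)]
    congr 1
    ext b
    simp only [Finset.mem_filter, Finset.mem_univ, true_and, h3, slot_self (show 1 ≤ t by omega) hij,
      and_iff_right_iff_imp]
    have := slot_cases t i j b
    have := upperSlot_cases t i b
    omega
  · conv_rhs => rw [show t = 3 * t - 2 * t by omega, ← card_le_val]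
    congr 1
    ext b
    have hb := b.2
    simp only [Finset.mem_filter, Finset.mem_univ, true_and]
    have := slot_cases t i j b
    have := upperSlot_cases t i b
    have := slot_cases t i j a
    have := upperSlot_cases t i a
    omega
  · rw [Finset.card_eq_zero, Finset.filter_eq_empty_iff]
    rintro b - ⟨h, h'⟩
    exact absurd h' (slot_strictMono_top (by omega) (by omega) h).le.not_gt

lemma invCount_slotPerm {t i j : ℕ} (hit : i ≤ t) (hij : i < j) (hj : j ≤ 2 * t) :
    invCount (slotPerm t i j hit hj) = 3 * t ^ 2 - 3 * t + i + j := by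
  rw [invCount_eq_sum, Finset.sum_congr rfl fun a _ => card_inversions_label hit hij hj a,
    Fin.sum_univ_eq_sum_range (fun a => if a = 0 then j else if a < t then 2 * t
      else if a = t then i else if a < 2 * t then t else 0)]
  obtain ⟨s, rfl⟩ : ∃ s, t = s + 1 := ⟨t - 1, by omega⟩
  rw [show 3 * (s + 1) = (s + 1) + (s + 1) + (s + 1) by ring, Finset.sum_range_add,
    Finset.sum_range_add, Finset.sum_range_succ', Finset.sum_range_succ' _ s]
  have h1 : ∀ x ∈ Finset.range s, (if x + 1 = 0 then j else if x + 1 < s + 1 then 2 * (s + 1)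
      else if x + 1 = s + 1 then i else if x + 1 < 2 * (s + 1) then s + 1 else 0)
      = 2 * (s + 1) := by
    intro x hx
    have := Finset.mem_range.1 hx
    repeat' first | rw [if_neg (by omega)] | rw [if_pos (by omega)]
  have h2 : ∀ x ∈ Finset.range s, (if s + 1 + (x + 1) = 0 then j
      else if s + 1 + (x + 1) < s + 1 then 2 * (s + 1)
      else if s + 1 + (x + 1) = s + 1 then i
      else if s + 1 + (x + 1) < 2 * (s + 1) then s + 1 else 0) = s + 1 := by
    intro x hx
    have := Finset.mem_range.1 hx
    repeat' first | rw [if_neg (by omega)] | rw [if_pos (by omega)]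
  have h3 : ∀ x ∈ Finset.range (s + 1), (if s + 1 + (s + 1) + x = 0 then j
      else if s + 1 + (s + 1) + x < s + 1 then 2 * (s + 1)
      else if s + 1 + (s + 1) + x = s + 1 then i
      else if s + 1 + (s + 1) + x < 2 * (s + 1) then s + 1 else 0) = 0 := by
    intro x hx
    split_ifs <;> omega
  rw [Finset.sum_congr rfl h1, Finset.sum_congr rfl h2, Finset.sum_congr rfl h3]
  have h4 : 3 * (s + 1) ^ 2 - ((s + 1) + (s + 1) + (s + 1)) = 3 * s ^ 2 + 3 * s :=
    Nat.sub_eq_of_eq_add (by ring)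
  simp [h4]
  ring

/-- A down-closed property of the values of `p` is given by a threshold. -/
lemma exists_threshold {S : ℕ → Prop} {p : ℕ → ℕ} {Q : ℕ → Prop} {n : ℕ}
    (hp : ∀ l, S l → p l < n) (hQ : ∀ l l', S l → S l' → p l ≤ p l' → Q l' → Q l) :
    ∃ k ≤ n, ∀ l, S l → (p l < k ↔ Q l) := by
  classical
  have hex : ∃ k, k = n ∨ ∃ l, S l ∧ p l = k ∧ ¬ Q l := ⟨n, Or.inl rfl⟩
  refine ⟨Nat.find hex, Nat.find_min' hex (Or.inl rfl), fun l hl => ⟨fun h => ?_, fun h => ?_⟩⟩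
  · by_contra hq
    exact Nat.find_min hex h (Or.inr ⟨l, hl, rfl, hq⟩)
  · by_contra hlt
    rcases Nat.find_spec hex with h' | ⟨l', hl', he, hq⟩
    · exact hlt (by rw [h']; exact hp l hl)
    · exact hq (hQ l' l hl' hl (by omega) h)

/-- A labelling by positions satisfying the constraints of a `1243`-avoiding linear extension is
ordered like some `slot t i j`. -/
lemma exists_slot_order {t : ℕ} (ht : 1 ≤ t) (u : ℕ → ℕ)
    (hinj : ∀ a b, a < 3 * t → b < 3 * t → u a = u b → a = b)
    (hrow : ∀ a, a + 1 < 3 * t → ¬ t ∣ a + 1 → u a < u (a + 1))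
    (hcol : ∀ a, a + t < 3 * t → u (a + t) < u a)
    (hav : ∀ a b c d, a < b → b < c → c < d → d < 3 * t →
      u a < u b → u b < u d → ¬ u d < u c) :
    ∃ i j, 1 ≤ i ∧ i ≤ t ∧ i < j ∧ j ≤ 2 * t ∧
      ∀ a b, a < 3 * t → b < 3 * t → slot t i j a < slot t i j b → u a < u b := by
  have hchain : ∀ r < 3, ∀ m n, m < n → n < t → u (r * t + m) < u (r * t + n) := by
    intro r hr m n hmn
    induction n, hmn using Nat.le_induction with
    | base =>
      intro h
      refine hrow (r * t + m) (by interval_cases r <;> omega) fun hd => ?_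
      rw [add_assoc] at hd
      have := Nat.le_of_dvd (by omega) ((Nat.dvd_add_right ⟨r, mul_comm _ _⟩).1 hd)
      omega
    | succ n hn ih =>
      intro h
      refine (ih (by omega)).trans (hrow (r * t + n) (by interval_cases r <;> omega) fun hd => ?_)
      rw [add_assoc] at hd
      have := Nat.le_of_dvd (by omega) ((Nat.dvd_add_right ⟨r, mul_comm _ _⟩).1 hd)
      omega
  have hC : ∀ a b, a < b → b < t → u a < u b := fun a b h1 h2 => by
    simpa using hchain 0 (by omega) a b h1 h2
  have hB : ∀ a b, t ≤ a → a < b → b < 2 * t → u a < u b := fun a b h0 h1 h2 => by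
    have := hchain 1 (by omega) (a - t) (b - t) (by omega) (by omega)
    rwa [show 1 * t + (a - t) = a by omega, show 1 * t + (b - t) = b by omega] at this
  have hA : ∀ a b, 2 * t ≤ a → a < b → b < 3 * t → u a < u b := fun a b h0 h1 h2 => by
    have := hchain 2 (by omega) (a - 2 * t) (b - 2 * t) (by omega) (by omega)
    rwa [show 2 * t + (a - 2 * t) = a by omega, show 2 * t + (b - 2 * t) = b by omega] at this
  have hlastB : ∀ a, 2 * t ≤ a → a < 3 * t → u a < u (2 * t - 1) := by
    intro a h1 h2
    have h3 := hcol (2 * t - 1) (by omega)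
    rcases (show a ≤ 2 * t - 1 + t by omega).eq_or_lt with rfl | h
    · exact h3
    · exact (hA _ _ h1 h (by omega)).trans h3
  have hlastC : ∀ a, t ≤ a → a < 3 * t → u a < u (t - 1) := by
    have h3 := hcol (t - 1) (by omega)
    rw [show t - 1 + t = 2 * t - 1 by omega] at h3
    intro a h1 h2
    rcases lt_or_ge a (2 * t) with h | h
    · rcases (show a ≤ 2 * t - 1 by omega).eq_or_lt with rfl | h'
      · exact h3
      · exact (hB _ _ h1 h' (by omega)).trans h3
    · exact (hlastB a h h2).trans h3
  have hAB : ∀ a b, 2 * t ≤ a → a < 3 * t → t < b → b < 2 * t → u a < u b := by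
    intro a b h1 h2 h3 h4
    by_contra hlt
    have hne : u b ≠ u a := fun h => by have := hinj b a (by omega) h2 h; omega
    have hl := hlastB a h1 h2
    have hb : b ≠ 2 * t - 1 := by rintro rfl; exact hlt hl
    exact hav t b (2 * t - 1) a h3 (by omega) (by omega) h2 (hB _ _ le_rfl h3 h4) (by omega) hl
  have hUC : ∀ a b, t ≤ a → a < 3 * t → 0 < b → b < t → u a < u b := by
    intro a b h1 h2 h3 h4
    by_contra hlt
    have hne : u b ≠ u a := fun h => by have := hinj b a (by omega) h2 h; omega
    have hl := hlastC a h1 h2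
    have hb : b ≠ t - 1 := by rintro rfl; exact hlt hl
    exact hav 0 b (t - 1) a h3 (by omega) (by omega) h2 (hC _ _ h3 h4) (by omega) hl
  obtain ⟨i, hit, hi⟩ := exists_threshold (S := fun l => 2 * t ≤ l ∧ l < 3 * t)
    (p := fun l => l - 2 * t) (Q := fun l => u l < u t) (n := t) (fun l hl => by omega)
    (fun l l' hl hl' h hq => by
      rcases (show l ≤ l' by omega).eq_or_lt with rfl | h
      · exact hq
      · exact (hA _ _ hl.1 h hl'.2).trans hq)
  have hi1 : 1 ≤ i := by
    have h0 := (hi (2 * t) (by omega)).2 (by have := hcol t (by omega); rwa [two_mul])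
    omega
  have hupper : ∀ a b, t ≤ a → a < 3 * t → t ≤ b → b < 3 * t →
      upperSlot t i a < upperSlot t i b → u a < u b := by
    intro a b h1 h2 h3 h4 h
    rcases lt_or_ge a (2 * t) with ha | ha <;> rcases lt_or_ge b (2 * t) with hb | hb
    · refine hB a b h1 ?_ hb
      have := upperSlot_cases t i a
      have := upperSlot_cases t i b
      omega
    · obtain rfl : a = t := by
        have := upperSlot_cases t i a
        have := upperSlot_cases t i b
        omega
      have hib : ¬ b - 2 * a < i := by
        have := upperSlot_cases a i a
        have := upperSlot_cases a i b
        omega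
      have := mt (hi b ⟨hb, h4⟩).2 hib
      have hne : u a ≠ u b := fun h => by have := hinj a b h2 h4 h; omega
      omega
    · rcases h3.eq_or_lt' with hbt | h3
      · rw [hbt] at h ⊢
        refine (hi a ⟨ha, h2⟩).1 ?_
        have := upperSlot_cases t i a
        have := upperSlot_cases t i t
        omega
      · exact hAB a b ha h2 h3 hb
    · refine hA a b ha ?_ h4
      have := upperSlot_cases t i a
      have := upperSlot_cases t i b
      omega
  obtain ⟨j, hj, hjl⟩ := exists_threshold (S := fun l => t ≤ l ∧ l < 3 * t)
    (p := upperSlot t i) (Q := fun l => u l < u 0) (n := 2 * t)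
    (fun l hl => (upperSlot_lt hit ht hl.2).resolve_right (by omega))
    (fun l l' hl hl' h hq => by
      rcases h.eq_or_lt with h | h
      · rwa [upperSlot_inj hit hl.1 hl'.1 hl.2 hl'.2 h]
      · exact (hupper _ _ hl.1 hl.2 hl'.1 hl'.2 h).trans hq)
  have hij : i < j := by
    have := (hjl t (by omega)).2 (by simpa using hcol 0 (by omega))
    simpa [upperSlot] using this
  refine ⟨i, j, hi1, hit, hij, hj, fun a b ha hb h => ?_⟩
  rcases lt_or_ge a t with hat | hat <;> rcases lt_or_ge b t with hbt | hbt
  · refine hC a b ?_ hbt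
    have := slot_cases t i j a
    have := slot_cases t i j b
    omega
  · have hb2 := (upperSlot_lt hit ht hb).resolve_right (by omega)
    obtain rfl : a = 0 := by
      by_contra h0
      rw [slot_lower h0 hat] at h
      have := slot_upper_lt hit hj hbt hb
      omega
    have hjb : ¬ upperSlot t i b < j := by
      have := slot_cases t i j 0
      have := slot_cases t i j b
      omega
    have := mt (hjl b ⟨hbt, hb⟩).2 hjb
    have hne : u 0 ≠ u b := fun h => by have := hinj 0 b ha hb h; omega
    omega
  · rcases Nat.eq_zero_or_pos b with rfl | h0
    · refine (hjl a ⟨hat, ha⟩).1 ?_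
      have := slot_cases t i j a
      have := slot_cases t i j 0
      omega
    · exact hUC a b hat ha h0 hbt
  · refine hupper a b hat ha hbt hb ?_
    have := slot_cases t i j a
    have := slot_cases t i j b
    omega

lemma exists_eq_slotPerm {t : ℕ} (ht : 1 ≤ t) {w : Equiv.Perm (Fin (3 * t))}
    (hw : IsLinExtN 3 t w) (hav : ¬ PermContains w pat1243) :
    ∃ (i j : ℕ) (_ : 1 ≤ i) (hit : i ≤ t) (_ : i < j) (hj : j ≤ 2 * t),
      slotPerm t i j hit hj = w := by
  rw [permContains_pat1243_iff] at hav
  let u : ℕ → ℕ := fun l => if h : l < 3 * t then (w.symm ⟨l, h⟩ : ℕ) else 0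
  have hu : ∀ l (h : l < 3 * t), u l = w.symm ⟨l, h⟩ := fun l h => dif_pos h
  obtain ⟨i, j, hi, hit, hij, hj, h⟩ := exists_slot_order ht u
    (fun a b ha hb h => by
      rw [hu a ha, hu b hb] at h
      simpa using w.symm.injective (Fin.ext h))
    (fun a ha hd => by
      rw [hu a (by omega), hu _ ha]
      exact hw.1 _ _ rfl hd)
    (fun a ha => by
      rw [hu a (by omega), hu _ ha]
      exact hw.2 _ _ rfl)
    (fun a b c d hab hbc hcd hd h1 h2 h3 => by
      rw [hu a (by omega), hu b (by omega)] at h1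
      rw [hu d hd, hu b (by omega)] at h2
      rw [hu d hd, hu c (by omega)] at h3
      exact hav ⟨_, _, _, _, hab, hbc, hcd, h1, h2, h3⟩)
  refine ⟨i, j, hi, hit, hij, hj, ?_⟩
  have hmono : StrictMono fun x => w.symm (slotPerm t i j hit hj x) := by
    intro x y hxy
    have := h (slotPerm t i j hit hj x) (slotPerm t i j hit hj y) (Fin.is_lt _) (Fin.is_lt _) (by
      rwa [← slotPerm_symm_val hit hj, ← slotPerm_symm_val hit hj, Equiv.symm_apply_apply,
        Equiv.symm_apply_apply])
    rwa [hu _ (Fin.is_lt _), hu _ (Fin.is_lt _)] at this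
  have hid : (fun x => w.symm (slotPerm t i j hit hj x)) = id :=
    (hmono.range_inj strictMono_id).1
      ((((slotPerm t i j hit hj).trans w.symm).surjective.range_eq).trans Set.range_id.symm)
  ext1 x
  exact (Equiv.symm_apply_eq w).1 (congrFun hid x)

/-- For all `t ≥ 1`, `N_{3,t}(1243)(q) = Σ_{i=1}^{t} Σ_{j=i+1}^{2t} q^{3t²−3t+i+j}`. -/
theorem NPoly_three_t_1243_sum (t : ℕ) (ht : 1 ≤ t) :
    NPoly 3 t pat1243 =
      ∑ i ∈ Finset.Icc 1 t, ∑ j ∈ Finset.Icc (i + 1) (2 * t),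
        (X : Polynomial ℤ) ^ (3 * t ^ 2 - 3 * t + i + j) := by
  classical
  rw [NPoly, Finset.sum_sigma', eq_comm]
  have hmem : ∀ p : (_ : ℕ) × ℕ,
      p ∈ (Finset.Icc 1 t).sigma (fun i => Finset.Icc (i + 1) (2 * t)) ↔
        (1 ≤ p.1 ∧ p.1 ≤ t) ∧ p.1 < p.2 ∧ p.2 ≤ 2 * t := fun p => by
    rw [Finset.mem_sigma, Finset.mem_Icc, Finset.mem_Icc]
    rfl
  refine Finset.sum_bij
    (fun p hp => slotPerm t p.1 p.2 ((hmem p).1 hp).1.2 ((hmem p).1 hp).2.2) ?_ ?_ ?_ ?_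
  · intro p hp
    obtain ⟨⟨h1, h2⟩, h3, h4⟩ := (hmem p).1 hp
    exact Finset.mem_filter.2 ⟨Finset.mem_univ _, isLinExtN_slotPerm h1 h2 h3 h4,
      not_permContains_slotPerm h2 h3 h4⟩
  · rintro ⟨i, j⟩ hp ⟨i', j'⟩ hp' h
    obtain ⟨⟨_, h2⟩, h3, h4⟩ := (hmem _).1 hp
    obtain ⟨⟨_, h2'⟩, h3', h4'⟩ := (hmem _).1 hp'
    have key : ∀ l (hl : l < 3 * t), slot t i j l = slot t i' j' l := fun l hl =>
      congrArg (fun w : Equiv.Perm (Fin (3 * t)) => (w.symm ⟨l, hl⟩ : ℕ)) h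
    have k0 := key 0 (by omega)
    have k1 := key t (by omega)
    rw [slot_zero, slot_zero] at k0
    rw [slot_self ht h3, slot_self ht h3'] at k1
    obtain rfl : i = i' := k1
    rw [k0]
  · intro w hw
    obtain ⟨-, hlin, hav⟩ := Finset.mem_filter.1 hw
    obtain ⟨i, j, h1, h2, h3, h4, h⟩ := exists_eq_slotPerm ht hlin hav
    exact ⟨⟨i, j⟩, (hmem _).2 ⟨⟨h1, h2⟩, h3, h4⟩, h⟩
  · intro p hp
    obtain ⟨⟨h1, h2⟩, h3, h4⟩ := (hmem p).1 hp
    rw [invCount_slotPerm h2 h3 h4]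
end
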